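/- Let M be a feasible matching in a marriage instance with critical men, and suppose some level assignment satisfies the min-size conditions for M. Then M is a popular feasible matching, i.e., φ(N,M) ≤ φ(M,N) for every feasible matching N. -/

import Mathlib

open Classical

universe u v

/-- A marriage instance with critical men: a finite bipartite graph with edge set `E ⊆ A × B`,
a set `C ⊆ A` of critical men, and strict preference orders of each vertex over its
neighbours (`prefA m w w'` : man `m` strictly prefers woman `w` to woman `w'`;
`prefB w m m'` : woman `w` strictly prefers man `m` to man `m'`). -/
structure CritInstance (A : Type u) (B : Type v) where
  E : Finset (A × B)
  C : Finset A
  prefA : A → B → B → Prop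
  prefB : B → A → A → Prop
  prefA_irrefl : ∀ m w, ¬ prefA m w w
  prefA_trans : ∀ m w₁ w₂ w₃, prefA m w₁ w₂ → prefA m w₂ w₃ → prefA m w₁ w₃
  prefA_total : ∀ m w₁ w₂, (m, w₁) ∈ E → (m, w₂) ∈ E → w₁ ≠ w₂ →
    prefA m w₁ w₂ ∨ prefA m w₂ w₁
  prefB_irrefl : ∀ w m, ¬ prefB w m m
  prefB_trans : ∀ w m₁ m₂ m₃, prefB w m₁ m₂ → prefB w m₂ m₃ → prefB w m₁ m₃
  prefB_total : ∀ w m₁ m₂, (m₁, w) ∈ E → (m₂, w) ∈ E → m₁ ≠ m₂ →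
    prefB w m₁ m₂ ∨ prefB w m₂ m₁

namespace CritInstance

variable {A : Type u} {B : Type v}

/-- `M` is a matching: a set of edges in which every vertex has at most one partner. -/
def IsMatching (I : CritInstance A B) (M : Finset (A × B)) : Prop :=
  M ⊆ I.E ∧ (∀ ⦃m w w'⦄, (m, w) ∈ M → (m, w') ∈ M → w = w') ∧
    (∀ ⦃m m' w⦄, (m, w) ∈ M → (m', w) ∈ M → m = m')

/-- Man `m` is matched in `M`. -/
def ManMatched (M : Finset (A × B)) (m : A) : Prop := ∃ w, (m, w) ∈ M

/-- Woman `w` is matched in `M`. -/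
def WomanMatched (M : Finset (A × B)) (w : B) : Prop := ∃ m, (m, w) ∈ M

/-- `M` is feasible: it is a matching and every critical man is matched. -/
def IsFeasible (I : CritInstance A B) (M : Finset (A × B)) : Prop :=
  IsMatching I M ∧ ∀ m ∈ I.C, ManMatched M m

/-- Man `m` prefers matching `M` to matching `N`: he is matched in `M` and either
unmatched in `N` or strictly prefers his `M`-partner to his `N`-partner. -/
def ManPrefers (I : CritInstance A B) (M N : Finset (A × B)) (m : A) : Prop :=
  ∃ w, (m, w) ∈ M ∧ (¬ ManMatched N m ∨ ∃ w', (m, w') ∈ N ∧ I.prefA m w w')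

/-- Woman `w` prefers matching `M` to matching `N`. -/
def WomanPrefers (I : CritInstance A B) (M N : Finset (A × B)) (w : B) : Prop :=
  ∃ m, (m, w) ∈ M ∧ (¬ WomanMatched N w ∨ ∃ m', (m', w) ∈ N ∧ I.prefB w m m')

/-- `phi I M N` is the number of vertices that prefer `M` to `N`. -/
noncomputable def phi [Fintype A] [Fintype B] (I : CritInstance A B)
    (M N : Finset (A × B)) : ℕ :=
  (Finset.univ.filter fun m : A => ManPrefers I M N m).card +
    (Finset.univ.filter fun w : B => WomanPrefers I M N w).card

/-- `M` is a popular feasible matching. -/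
def IsPFM [Fintype A] [Fintype B] (I : CritInstance A B) (M : Finset (A × B)) : Prop :=
  IsFeasible I M ∧ ∀ N, IsFeasible I N → phi I N M ≤ phi I M N

/-- `M` is a minimum size popular feasible matching. -/
def IsMinPFM [Fintype A] [Fintype B] (I : CritInstance A B) (M : Finset (A × B)) : Prop :=
  IsPFM I M ∧ ∀ N, IsPFM I N → M.card ≤ N.card

/-- `M` is a dominant feasible matching. -/
def IsDFM [Fintype A] [Fintype B] (I : CritInstance A B) (M : Finset (A × B)) : Prop :=
  IsPFM I M ∧ ∀ N, IsFeasible I N → M.card < N.card → phi I N M < phi I M N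

/-- `(m,w)` is a `(+1,+1)` edge with respect to `M`: an edge of `E ∖ M` such that `m` is
unmatched or prefers `w` to his partner, and `w` is unmatched or prefers `m` to her partner. -/
def PlusPlus (I : CritInstance A B) (M : Finset (A × B)) (m : A) (w : B) : Prop :=
  (m, w) ∈ I.E ∧ (m, w) ∉ M ∧
    (¬ ManMatched M m ∨ ∃ w', (m, w') ∈ M ∧ I.prefA m w w') ∧
    (¬ WomanMatched M w ∨ ∃ m', (m', w) ∈ M ∧ I.prefB w m m')

/-- `(m,w)` is a `(−1,−1)` edge with respect to `M`: an edge of `E ∖ M` such that `m` is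
matched and prefers his partner to `w`, and `w` is matched and prefers her partner to `m`. -/
def MinusMinus (I : CritInstance A B) (M : Finset (A × B)) (m : A) (w : B) : Prop :=
  (m, w) ∈ I.E ∧ (m, w) ∉ M ∧
    (∃ w', (m, w') ∈ M ∧ I.prefA m w' w) ∧
    (∃ m', (m', w) ∈ M ∧ I.prefB w m' m)

/-- `M` is a stable matching: a matching with no blocking pair. -/
def IsStable (I : CritInstance A B) (M : Finset (A × B)) : Prop :=
  IsMatching I M ∧ ∀ m w, ¬ PlusPlus I M m w

/-- The min-size conditions for a level assignment `(lA, lB)` with respect to `M`: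
(i) matched partners share a level, unmatched vertices have level 0, non-critical men
have level 0; (ii) every `(+1,+1)` edge goes from a man to a strictly higher level woman;
(iii) every edge from a man at level `i` to a woman at level `i − 1` is a `(−1,−1)` edge;
(iv) no edge goes from a man at level `i` to a woman at level `≤ i − 2`. -/
def MinSizeConds (I : CritInstance A B) (M : Finset (A × B))
    (lA : A → ℕ) (lB : B → ℕ) : Prop :=
  (∀ m w, (m, w) ∈ M → lA m = lB w) ∧
  (∀ m, ¬ ManMatched M m → lA m = 0) ∧
  (∀ w, ¬ WomanMatched M w → lB w = 0) ∧
  (∀ m, m ∉ I.C → lA m = 0) ∧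
  (∀ m w, PlusPlus I M m w → lA m < lB w) ∧
  (∀ m w, (m, w) ∈ I.E → lB w + 1 = lA m → MinusMinus I M m w) ∧
  (∀ m w, (m, w) ∈ I.E → ¬ (lB w + 2 ≤ lA m))

/-- The dominant conditions for a level assignment `(lA, lB)` with respect to `M`:
(i) matched partners share a level, unmatched women have level 0, unmatched men have
level 1, non-critical men have level at most 1; (ii)–(iv) as in the min-size conditions. -/
def DomConds (I : CritInstance A B) (M : Finset (A × B))
    (lA : A → ℕ) (lB : B → ℕ) : Prop :=
  (∀ m w, (m, w) ∈ M → lA m = lB w) ∧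
  (∀ m, ¬ ManMatched M m → lA m = 1) ∧
  (∀ w, ¬ WomanMatched M w → lB w = 0) ∧
  (∀ m, m ∉ I.C → lA m ≤ 1) ∧
  (∀ m w, PlusPlus I M m w → lA m < lB w) ∧
  (∀ m w, (m, w) ∈ I.E → lB w + 1 = lA m → MinusMinus I M m w) ∧
  (∀ m w, (m, w) ∈ I.E → ¬ (lB w + 2 ≤ lA m))

/-- Adjacency in the bipartite graph, on the vertex set `A ⊕ B`. -/
def Adj (I : CritInstance A B) : A ⊕ B → A ⊕ B → Prop
  | Sum.inl m, Sum.inr w => (m, w) ∈ I.E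
  | Sum.inr w, Sum.inl m => (m, w) ∈ I.E
  | _, _ => False

/-- The (directed) pair `(u, v)` of vertices spans an edge of the matching `M`. -/
def StepM (M : Finset (A × B)) : A ⊕ B → A ⊕ B → Prop
  | Sum.inl m, Sum.inr w => (m, w) ∈ M
  | Sum.inr w, Sum.inl m => (m, w) ∈ M
  | _, _ => False

/-- The pair `(u, v)` of vertices spans a `(+1,+1)` edge with respect to `M`. -/
def StepPP (I : CritInstance A B) (M : Finset (A × B)) : A ⊕ B → A ⊕ B → Prop
  | Sum.inl m, Sum.inr w => PlusPlus I M m w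
  | Sum.inr w, Sum.inl m => PlusPlus I M m w
  | _, _ => False

/-- The pair `(u, v)` of vertices spans a `(−1,−1)` edge with respect to `M`. -/
def StepMM (I : CritInstance A B) (M : Finset (A × B)) : A ⊕ B → A ⊕ B → Prop
  | Sum.inl m, Sum.inr w => MinusMinus I M m w
  | Sum.inr w, Sum.inl m => MinusMinus I M m w
  | _, _ => False

/-- A vertex of `A ⊕ B` is matched in `M`. -/
def VMatched (M : Finset (A × B)) : A ⊕ B → Prop
  | Sum.inl m => ManMatched M m
  | Sum.inr w => WomanMatched M w

/-- An `M`-alternating path in the graph: a sequence of distinct vertices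
`vert 0, …, vert len` (`len ≥ 1` edges), consecutive vertices adjacent, with
consecutive edges alternately inside and outside `M`. -/
structure AltPath (I : CritInstance A B) (M : Finset (A × B)) where
  len : ℕ
  len_pos : 0 < len
  vert : ℕ → A ⊕ B
  inj : ∀ i j, i ≤ len → j ≤ len → vert i = vert j → i = j
  adj : ∀ i, i < len → Adj I (vert i) (vert (i + 1))
  alternate : ∀ i, i + 1 < len →
    (StepM M (vert i) (vert (i + 1)) ↔ ¬ StepM M (vert (i + 1)) (vert (i + 2)))

namespace AltPath

variable {I : CritInstance A B} {M : Finset (A × B)}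

/-- The number of `(+1,+1)` edges of the path. -/
noncomputable def countPP (ρ : AltPath I M) : ℕ :=
  ((Finset.range ρ.len).filter fun i => StepPP I M (ρ.vert i) (ρ.vert (i + 1))).card

/-- The number of `(−1,−1)` edges of the path. -/
noncomputable def countMM (ρ : AltPath I M) : ℕ :=
  ((Finset.range ρ.len).filter fun i => StepMM I M (ρ.vert i) (ρ.vert (i + 1))).card

/-- The vertex `u` lies on the path. -/
def Mem (ρ : AltPath I M) (u : A ⊕ B) : Prop := ∃ i ≤ ρ.len, ρ.vert i = u

/-- The set of edges of the path, as a set of pairs in `A × B`. -/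
noncomputable def edges (ρ : AltPath I M) : Finset (A × B) :=
  I.E.filter fun e => ∃ i < ρ.len,
    (ρ.vert i = Sum.inl e.1 ∧ ρ.vert (i + 1) = Sum.inr e.2) ∨
    (ρ.vert i = Sum.inr e.2 ∧ ρ.vert (i + 1) = Sum.inl e.1)

end AltPath

/-- An `M`-alternating cycle: a closed sequence of vertices `vert 0, …, vert len = vert 0`
(distinct except for the return), consecutive vertices adjacent, with edges alternately
inside and outside `M`, including around the wrap. -/
structure AltCycle (I : CritInstance A B) (M : Finset (A × B)) where
  len : ℕ
  len_pos : 0 < len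
  vert : ℕ → A ⊕ B
  closed : vert len = vert 0
  inj : ∀ i j, i < len → j < len → vert i = vert j → i = j
  adj : ∀ i, i < len → Adj I (vert i) (vert (i + 1))
  alternate : ∀ i, i + 1 < len →
    (StepM M (vert i) (vert (i + 1)) ↔ ¬ StepM M (vert (i + 1)) (vert (i + 2)))
  alternate_wrap : StepM M (vert (len - 1)) (vert len) ↔ ¬ StepM M (vert 0) (vert 1)

namespace AltCycle

variable {I : CritInstance A B} {M : Finset (A × B)}

/-- The number of `(+1,+1)` edges of the cycle. -/
noncomputable def countPP (σ : AltCycle I M) : ℕ :=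
  ((Finset.range σ.len).filter fun i => StepPP I M (σ.vert i) (σ.vert (i + 1))).card

/-- The number of `(−1,−1)` edges of the cycle. -/
noncomputable def countMM (σ : AltCycle I M) : ℕ :=
  ((Finset.range σ.len).filter fun i => StepMM I M (σ.vert i) (σ.vert (i + 1))).card

end AltCycle

/-- A size-increasing alternating path (SIAP) for `M`: an `M`-alternating path whose two
endpoints are a man unmatched in `M` and a woman unmatched in `M`, and which has equally
many `(+1,+1)` and `(−1,−1)` edges. -/
def IsSIAP (I : CritInstance A B) (M : Finset (A × B)) (ρ : AltPath I M) : Prop :=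
  (((∃ m, ρ.vert 0 = Sum.inl m ∧ ¬ ManMatched M m) ∧
      (∃ w, ρ.vert ρ.len = Sum.inr w ∧ ¬ WomanMatched M w)) ∨
    ((∃ w, ρ.vert 0 = Sum.inr w ∧ ¬ WomanMatched M w) ∧
      (∃ m, ρ.vert ρ.len = Sum.inl m ∧ ¬ ManMatched M m))) ∧
  ρ.countPP = ρ.countMM

/-- A size-reducing alternating path (SRAP) for `M` with respect to the level assignment
`(lA, lB)`: an `M`-alternating path both of whose terminal edges lie in `M`, starting at a
woman matched in `M` at level 0, ending at a non-critical man at level 1, whose number of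
`(+1,+1)` edges is exactly one more than its number of `(−1,−1)` edges. -/
def IsSRAP (I : CritInstance A B) (M : Finset (A × B)) (lA : A → ℕ) (lB : B → ℕ)
    (ρ : AltPath I M) : Prop :=
  StepM M (ρ.vert 0) (ρ.vert 1) ∧
  StepM M (ρ.vert (ρ.len - 1)) (ρ.vert ρ.len) ∧
  (((∃ w, ρ.vert 0 = Sum.inr w ∧ WomanMatched M w ∧ lB w = 0) ∧
      (∃ m, ρ.vert ρ.len = Sum.inl m ∧ m ∉ I.C ∧ lA m = 1)) ∨
    ((∃ m, ρ.vert 0 = Sum.inl m ∧ m ∉ I.C ∧ lA m = 1) ∧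
      (∃ w, ρ.vert ρ.len = Sum.inr w ∧ WomanMatched M w ∧ lB w = 0))) ∧
  ρ.countPP = ρ.countMM + 1

end CritInstance

namespace CritInstance

section Vote

variable {X : Type*} (P : X → X → Prop) (N M : X → Prop)

/-- A vertex with preference order `P` prefers its partner in `N` to its partner in `M`, where
`N` and `M` are given as the predicates of being a partner of the vertex. -/
def Prefers : Prop :=
  ∃ x, N x ∧ ((¬ ∃ y, M y) ∨ ∃ y, M y ∧ P x y)

/-- The vote (`1`, `0` or `-1`) of a vertex for `N` against `M`. -/
noncomputable def vote : ℤ :=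
  (if Prefers P N M then 1 else 0) - (if Prefers P M N then 1 else 0)

variable {P N M}

theorem vote_le_one : vote P N M ≤ 1 := by
  unfold vote; split_ifs <;> norm_num

theorem vote_nonpos_of_not_prefers (h : ¬ Prefers P N M) : vote P N M ≤ 0 := by
  unfold vote; split_ifs <;> norm_num

theorem vote_nonpos_of_unmatched (h : ¬ ∃ x, N x) : vote P N M ≤ 0 :=
  vote_nonpos_of_not_prefers fun ⟨x, hx, _⟩ => h ⟨x, hx⟩

theorem vote_nonpos_of_common (irrefl : ∀ x, ¬ P x x)
    (uN : ∀ x y, N x → N y → x = y) (uM : ∀ x y, M x → M y → x = y)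
    {x : X} (hN : N x) (hM : M x) : vote P N M ≤ 0 := by
  refine vote_nonpos_of_not_prefers ?_
  rintro ⟨a, ha, hn | ⟨b, hb, hab⟩⟩
  · exact hn ⟨x, hM⟩
  · obtain rfl := uN _ _ ha hN
    obtain rfl := uM _ _ hb hM
    exact irrefl _ hab

theorem vote_le_neg_one (irrefl : ∀ x, ¬ P x x)
    (trans : ∀ x y z, P x y → P y z → P x z)
    (uN : ∀ x y, N x → N y → x = y) (uM : ∀ x y, M x → M y → x = y)
    {x y : X} (hN : N x) (hM : M y) (hyx : P y x) : vote P N M ≤ -1 := by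
  have hNM : ¬ Prefers P N M := by
    rintro ⟨a, ha, hn | ⟨b, hb, hab⟩⟩
    · exact hn ⟨y, hM⟩
    · obtain rfl := uN _ _ ha hN
      obtain rfl := uM _ _ hb hM
      exact irrefl _ (trans _ _ _ hab hyx)
  have hMN : Prefers P M N := ⟨y, hM, Or.inr ⟨x, hN, hyx⟩⟩
  simp [vote, hNM, hMN]

end Vote

variable {A : Type u} {B : Type v}

/-- The vote of man `m` for `N` against `M`. -/
noncomputable def manVote (I : CritInstance A B) (N M : Finset (A × B)) (m : A) : ℤ :=
  vote (I.prefA m) (fun w => (m, w) ∈ N) (fun w => (m, w) ∈ M)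

/-- The vote of woman `w` for `N` against `M`. -/
noncomputable def womanVote (I : CritInstance A B) (N M : Finset (A × B)) (w : B) : ℤ :=
  vote (I.prefB w) (fun m => (m, w) ∈ N) (fun m => (m, w) ∈ M)

theorem phi_sub_phi [Fintype A] [Fintype B] (I : CritInstance A B) (N M : Finset (A × B)) :
    (I.phi N M : ℤ) - I.phi M N = ∑ m, I.manVote N M m + ∑ w, I.womanVote N M w := by
  have hA : ∑ m, I.manVote N M m =
      ((Finset.univ.filter fun m : A => ManPrefers I N M m).card : ℤ) -
        (Finset.univ.filter fun m : A => ManPrefers I M N m).card := by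
    simp only [Finset.natCast_card_filter, ← Finset.sum_sub_distrib]
    rfl
  have hB : ∑ w, I.womanVote N M w =
      ((Finset.univ.filter fun w : B => WomanPrefers I N M w).card : ℤ) -
        (Finset.univ.filter fun w : B => WomanPrefers I M N w).card := by
    simp only [Finset.natCast_card_filter, ← Finset.sum_sub_distrib]
    rfl
  rw [hA, hB, phi, phi]
  push_cast
  ring

/-- Vertex weights that are nonpositive on every edge of a matching `K` and on every vertex
unmatched in `K` have nonpositive total. -/
theorem IsMatching.sum_add_sum_nonpos [Fintype A] [Fintype B] {I : CritInstance A B}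
    {K : Finset (A × B)} (hK : I.IsMatching K) {f : A → ℤ} {g : B → ℤ}
    (edge : ∀ m w, (m, w) ∈ K → f m + g w ≤ 0)
    (man : ∀ m, ¬ ManMatched K m → f m ≤ 0)
    (woman : ∀ w, ¬ WomanMatched K w → g w ≤ 0) :
    ∑ m, f m + ∑ w, g w ≤ 0 := by
  have hA : ∑ m, f m ≤ ∑ e ∈ K, f e.1 := by
    have hinj : Set.InjOn Prod.fst (K : Set (A × B)) := by
      rintro ⟨m, w⟩ h ⟨m', w'⟩ h' (rfl : m = m')
      exact Prod.ext rfl (hK.2.1 h h')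
    rw [← Finset.sum_image (f := f) hinj,
      ← Finset.sum_add_sum_compl (K.image Prod.fst)]
    refine add_le_of_nonpos_right (Finset.sum_nonpos fun m hm => man m ?_)
    rintro ⟨w, hw⟩
    exact Finset.mem_compl.1 hm (Finset.mem_image_of_mem Prod.fst hw)
  have hB : ∑ w, g w ≤ ∑ e ∈ K, g e.2 := by
    have hinj : Set.InjOn Prod.snd (K : Set (A × B)) := by
      rintro ⟨m, w⟩ h ⟨m', w'⟩ h' (rfl : w = w')
      exact Prod.ext (hK.2.2 h h') rfl
    rw [← Finset.sum_image (f := g) hinj,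
      ← Finset.sum_add_sum_compl (K.image Prod.snd)]
    refine add_le_of_nonpos_right (Finset.sum_nonpos fun w hw => woman w ?_)
    rintro ⟨m, hm⟩
    exact Finset.mem_compl.1 hw (Finset.mem_image_of_mem Prod.snd hm)
  have hE : ∑ e ∈ K, (f e.1 + g e.2) ≤ 0 := Finset.sum_nonpos fun e he => edge e.1 e.2 he
  rw [Finset.sum_add_distrib] at hE
  linarith

section Edge

variable {I : CritInstance A B} {N M : Finset (A × B)} {m : A} {w : B}

theorem manVote_nonpos_of_common (hN : I.IsMatching N) (hM : I.IsMatching M)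
    (h : (m, w) ∈ N) (h' : (m, w) ∈ M) : I.manVote N M m ≤ 0 :=
  vote_nonpos_of_common (I.prefA_irrefl m) (fun _ _ a b => hN.2.1 a b)
    (fun _ _ a b => hM.2.1 a b) h h'

theorem womanVote_nonpos_of_common (hN : I.IsMatching N) (hM : I.IsMatching M)
    (h : (m, w) ∈ N) (h' : (m, w) ∈ M) : I.womanVote N M w ≤ 0 :=
  vote_nonpos_of_common (I.prefB_irrefl w) (fun _ _ a b => hN.2.2 a b)
    (fun _ _ a b => hM.2.2 a b) h h'

theorem manVote_le_neg_one (hN : I.IsMatching N) (hM : I.IsMatching M) (h : (m, w) ∈ N)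
    {w' : B} (h' : (m, w') ∈ M) (hp : I.prefA m w' w) : I.manVote N M m ≤ -1 :=
  vote_le_neg_one (I.prefA_irrefl m) (I.prefA_trans m) (fun _ _ a b => hN.2.1 a b)
    (fun _ _ a b => hM.2.1 a b) h h' hp

theorem womanVote_le_neg_one (hN : I.IsMatching N) (hM : I.IsMatching M) (h : (m, w) ∈ N)
    {m' : A} (h' : (m', w) ∈ M) (hp : I.prefB w m' m) : I.womanVote N M w ≤ -1 :=
  vote_le_neg_one (I.prefB_irrefl w) (I.prefB_trans w) (fun _ _ a b => hN.2.2 a b)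
    (fun _ _ a b => hM.2.2 a b) h h' hp

theorem manVote_le_one : I.manVote N M m ≤ 1 := vote_le_one

theorem womanVote_le_one : I.womanVote N M w ≤ 1 := vote_le_one

theorem votes_nonpos_of_not_plusPlus (hN : I.IsMatching N) (hM : I.IsMatching M)
    (h : (m, w) ∈ N) (hpp : ¬ I.PlusPlus M m w) :
    I.manVote N M m + I.womanVote N M w ≤ 0 := by
  have h₁ : I.manVote N M m ≤ 1 := manVote_le_one
  have h₂ : I.womanVote N M w ≤ 1 := womanVote_le_one
  by_cases hMe : (m, w) ∈ M
  · linarith [manVote_nonpos_of_common hN hM h hMe, womanVote_nonpos_of_common hN hM h hMe]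
  by_cases hm : ¬ ManMatched M m ∨ ∃ w', (m, w') ∈ M ∧ I.prefA m w w'
  · have hw : ¬ (¬ WomanMatched M w ∨ ∃ m', (m', w) ∈ M ∧ I.prefB w m m') :=
      fun hw => hpp ⟨hN.1 h, hMe, hm, hw⟩
    push Not at hw
    obtain ⟨⟨m', hm'⟩, hw⟩ := hw
    have hne : m' ≠ m := fun e => hMe (e ▸ hm')
    have hp := (I.prefB_total w m' m (hM.1 hm') (hN.1 h) hne).resolve_right (hw m' hm')
    linarith [womanVote_le_neg_one hN hM h hm' hp]
  · push Not at hm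
    obtain ⟨⟨w', hw'⟩, hm⟩ := hm
    have hne : w' ≠ w := fun e => hMe (e ▸ hw')
    have hp := (I.prefA_total m w' w (hM.1 hw') (hN.1 h) hne).resolve_right (hm w' hw')
    linarith [manVote_le_neg_one hN hM h hw' hp]

theorem MinSizeConds.votes_le {lA : A → ℕ} {lB : B → ℕ} (hl : I.MinSizeConds M lA lB)
    (hN : I.IsMatching N) (hM : I.IsMatching M) (h : (m, w) ∈ N) :
    I.manVote N M m + I.womanVote N M w ≤ 2 * lB w - 2 * lA m := by
  obtain ⟨-, -, -, -, hpp, hmm, hno⟩ := hl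
  rcases lt_trichotomy (lA m) (lB w) with hlt | heq | hgt
  · have h₁ : I.manVote N M m ≤ 1 := manVote_le_one
    have h₂ : I.womanVote N M w ≤ 1 := womanVote_le_one
    omega
  · have := votes_nonpos_of_not_plusPlus hN hM h fun hp => (hpp m w hp).ne heq
    omega
  · have hlev : lB w + 1 = lA m := by have := hno m w (hN.1 h); omega
    obtain ⟨-, -, ⟨w', hw', hpw⟩, m', hm', hpm⟩ := hmm m w (hN.1 h) hlev
    have h₁ := manVote_le_neg_one hN hM h hw' hpw
    have h₂ := womanVote_le_neg_one hN hM h hm' hpm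
    omega

end Edge

theorem MinSizeConds.sum_levels_le [Fintype A] [Fintype B] {I : CritInstance A B}
    {M : Finset (A × B)} {lA : A → ℕ} {lB : B → ℕ} (hl : I.MinSizeConds M lA lB)
    (hM : I.IsMatching M) :
    ∑ m, (-2 * lA m : ℤ) + ∑ w, (2 * lB w : ℤ) ≤ 0 := by
  obtain ⟨heq, -, hw, -⟩ := hl
  refine hM.sum_add_sum_nonpos (fun m w h => ?_) (fun m _ => ?_) (fun w h => ?_)
  · have := heq m w h
    omega
  · omega
  · simp [hw w h]

end CritInstance

/-- If `M` is a feasible matching and some level assignment satisfies the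
min-size conditions for `M`, then `M` is a popular feasible matching, i.e.
`φ(N,M) ≤ φ(M,N)` for every feasible matching `N`. -/
theorem minSizeConds_isPFM {A : Type u} {B : Type v} [Fintype A] [Fintype B]
    (I : CritInstance A B) (M : Finset (A × B)) (hM : I.IsFeasible M)
    (lA : A → ℕ) (lB : B → ℕ) (h : I.MinSizeConds M lA lB) :
    I.IsPFM M := by
  refine ⟨hM, fun N hN => ?_⟩
  have hsum := hN.1.sum_add_sum_nonpos
    (f := fun m => I.manVote N M m - (-2 * lA m)) (g := fun w => I.womanVote N M w - 2 * lB w)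
    (fun m w hmw => by have := h.votes_le hN.1 hM.1 hmw; omega)
    (fun m hm => by
      have hv : I.manVote N M m ≤ 0 := CritInstance.vote_nonpos_of_unmatched hm
      have hlev : lA m = 0 := h.2.2.2.1 m fun hC => hm (hN.2 m hC)
      omega)
    (fun w hw => by
      have hv : I.womanVote N M w ≤ 0 := CritInstance.vote_nonpos_of_unmatched hw
      omega)
  rw [Finset.sum_sub_distrib, Finset.sum_sub_distrib] at hsum
  have hlev := h.sum_levels_le hM.1
  have hphi := I.phi_sub_phi N M
  omega
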